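/- Let K be an algebraically closed field, N ≥ 2, d ≥ 2, and let F ∈ K[X_0,…,X_N] be a nonzero homogeneous polynomial of degree d such that the projective hypersurface {F = 0} ⊂ P^N_K is smooth. Then for every choice of integers α_0 ≤ α_1 ≤ ⋯ ≤ α_N, not all zero, with α_0 + ⋯ + α_N = 0, the α-degree of F satisfies deg_α(F) ≥ 0, where deg_α(F) is the maximum over the monomials X_0^{λ_0}⋯X_N^{λ_N} occurring in F of Σ_i α_i·λ_i. Moreover deg_α(F) > 0 if d ≥ 3. -/

import Mathlib

open MvPolynomial

noncomputable def killHom (K : Type*) [Field K] (n j : ℕ) :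
    MvPolynomial (Fin n) K →ₐ[K] MvPolynomial (Fin n) K :=
  aeval (fun i : Fin n => if (i : ℕ) < j then 0 else X i)

lemma killHom_height (K : Type*) [Field K] (n j : ℕ) (hj : j ≤ n) :
    (j : ℕ∞) ≤ (RingHom.ker (killHom K n j)).height := by
  induction j with
  | zero => simp
  | succ j ih =>
    have h1 := ih (by omega)
    have : (RingHom.ker (killHom K n j)).IsPrime := RingHom.ker_isPrime _
    have : (RingHom.ker (killHom K n (j+1))).IsPrime := RingHom.ker_isPrime _
    have hlt : RingHom.ker (killHom K n j) < RingHom.ker (killHom K n (j+1)) := by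
      rw [SetLike.lt_iff_le_and_exists]
      constructor
      · intro p hp
        have e : killHom K n (j+1) = (killHom K n (j+1)).comp (killHom K n j) := by
          apply MvPolynomial.algHom_ext
          intro i
          simp only [killHom, AlgHom.comp_apply, aeval_X]
          by_cases h : (i : ℕ) < j
          · rw [if_pos (by omega), if_pos h, map_zero]
          · rw [if_neg h, aeval_X]
        rw [RingHom.mem_ker] at hp ⊢
        rw [e, AlgHom.comp_apply, hp, map_zero]
      · refine ⟨X ⟨j, by omega⟩, ?_, ?_⟩ <;> simp [RingHom.mem_ker, killHom]
    have := Ideal.height_add_one_le_of_lt_of_isPrime hlt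
    push_cast
    exact le_trans (by gcongr) this

lemma exists_common_zero (K : Type*) [Field K] [IsAlgClosed K] (n : ℕ)
    (s : Set (MvPolynomial (Fin n) K)) (hfin : s.Finite) (hcard : s.ncard < n)
    (h0 : ∀ p ∈ s, eval (0 : Fin n → K) p = 0) :
    ∃ x : Fin n → K, x ≠ 0 ∧ ∀ p ∈ s, eval x p = 0 := by
  by_contra! hcon
  have hz : zeroLocus K (Ideal.span s) = {0} := by
    rw [zeroLocus_span]
    ext x
    simp only [Set.mem_ofPred_eq, Set.mem_singleton_iff, aeval_eq_eval]
    constructor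
    · intro h
      by_contra hx
      obtain ⟨p, hp, hp'⟩ := hcon x hx
      exact hp' (h p hp)
    · rintro rfl
      exact h0
  have hrad := vanishingIdeal_zeroLocus_eq_radical (K := K) (Ideal.span s)
  rw [hz] at hrad
  have hmin : (vanishingIdeal K {(0 : Fin n → K)}) ∈ (Ideal.span s).minimalPrimes := by
    rw [← Ideal.radical_minimalPrimes, ← hrad, Ideal.minimalPrimes_eq_subsingleton_self]
    rfl
  have h1 := Ideal.height_le_card_of_mem_minimalPrimes_span hfin hmin
  have h2 := killHom_height K n n le_rfl
  have e : RingHom.ker (killHom K n n) = vanishingIdeal K {(0 : Fin n → K)} := by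
    ext p
    rw [RingHom.mem_ker, mem_vanishingIdeal_singleton_iff]
    have : killHom K n n = (Algebra.ofId K _).comp (aeval (0 : Fin n → K)) := by
      apply MvPolynomial.algHom_ext
      intro i
      simp [killHom]
    rw [this, AlgHom.comp_apply]
    simp [Algebra.ofId_apply, algebraMap_eq]
  rw [e] at h2
  have := h2.trans h1
  norm_cast at this
  omega

/-- key bound -/
lemma key_bound (K : Type*) [Field K] [IsAlgClosed K] (N d : ℕ) (hd : 2 ≤ d)
    (F : MvPolynomial (Fin (N + 1)) K)
    (hFhom : F.IsHomogeneous d)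
    (hsmooth : ∀ x : Fin (N + 1) → K, x ≠ 0 →
      ¬ (eval x F = 0 ∧ ∀ i : Fin (N + 1), eval x (pderiv i F) = 0))
    (α : Fin (N + 1) → ℤ) (hmono : Monotone α) (u : Fin (N + 1)) (hu : u ≤ u.rev) :
    ∃ m ∈ F.support, α u + (d - 1) * α u.rev ≤ ∑ i, α i * (m i : ℤ) := by
  classical
  by_contra! hcon
  -- a monomial of F: bad index sum
  have hmon : ∀ m ∈ F.support, ∀ k : Fin (N+1), u ≤ k → m k ≠ 0 →
      ∃ i, i < u.rev ∧ (m - Finsupp.single k 1 : Fin (N+1) →₀ ℕ) i ≠ 0 := by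
    intro m hm k hk hmk
    by_contra! h
    have hlt := hcon m hm
    set q := m - Finsupp.single k 1 with hq
    have hmq : m = q + Finsupp.single k 1 := by
      rw [hq, tsub_add_cancel_of_le]
      rw [Finsupp.single_le_iff]; omega
    have hdeg : ∑ i, m i = d := by
      have := hFhom (mem_support_iff.mp hm)
      rw [← this, Finsupp.weight_apply, Finsupp.sum_fintype] <;> simp
    have e1 : ∑ i, α i * (m i : ℤ) = ∑ i, α i * (q i : ℤ) + α k := by
      rw [hmq]
      simp [mul_add, Finset.sum_add_distrib, Finsupp.single_apply]
    have e2 : ∑ i, (q i : ℤ) = d - 1 := by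
      have : (∑ i, (m i : ℤ)) = d := by exact_mod_cast hdeg
      rw [hmq] at this
      simp [Finset.sum_add_distrib, Finsupp.single_apply] at this
      linarith
    have e3 : (d - 1) * α u.rev ≤ ∑ i, α i * (q i : ℤ) := by
      rw [← e2, Finset.sum_mul]
      apply Finset.sum_le_sum
      intro i _
      by_cases hi : i < u.rev
      · simp [h i hi]
      · rw [mul_comm]
        exact mul_le_mul_of_nonneg_right (hmono (not_lt.mp hi)) (by positivity)
    have := hmono hk
    linarith
  let s : Set (MvPolynomial (Fin (N+1)) K) :=
    ((Finset.Iio u.rev).image (fun i => (X i : MvPolynomial (Fin (N+1)) K)) ∪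
      (Finset.Iio u).image (fun i => pderiv i F) : Finset _)
  have hcard : s.ncard < N + 1 := by
    simp only [s]
    rw [Set.ncard_coe_finset]
    refine (Finset.card_union_le _ _).trans_lt ?_
    refine (add_le_add Finset.card_image_le Finset.card_image_le).trans_lt ?_
    simp [Fin.val_rev]
    omega
  obtain ⟨x, hx, hxs⟩ := exists_common_zero K (N+1) s (Finset.finite_toSet _) hcard (by
    intro p hp
    simp only [s, Finset.coe_union, Finset.coe_image, Set.mem_union, Set.mem_image] at hp
    rcases hp with ⟨i, -, rfl⟩ | ⟨i, -, rfl⟩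
    · simp
    · change eval (fun _ => (0 : K)) _ = 0
      have h := (hFhom.pderiv (i := i)).coeff_eq_zero (d := 0) (by simp; omega)
      rw [← constantCoeff_eq] at h
      simpa [eval_zero'] using h)
  have hx0 : ∀ i < u.rev, x i = 0 := by
    intro i hi
    have := hxs (X i) (by simp only [s, Finset.coe_union, Finset.coe_image]; exact Or.inl ⟨i, by simpa using hi, rfl⟩)
    simpa using this
  have hmz : ∀ m ∈ F.support, ∀ k, u ≤ k → m k ≠ 0 → 
      ∏ i, x i ^ (m - Finsupp.single k 1 : Fin (N+1) →₀ ℕ) i = 0 := by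
    intro m hm k hk hmk
    obtain ⟨i, hi, hi'⟩ := hmon m hm k hk hmk
    exact Finset.prod_eq_zero (Finset.mem_univ i) (by rw [hx0 i hi, zero_pow hi'])
  apply hsmooth x hx
  constructor
  · rw [eval_eq']
    apply Finset.sum_eq_zero
    intro m hm
    by_cases h : ∃ i, i < u.rev ∧ m i ≠ 0
    · obtain ⟨i, hi, hi'⟩ := h
      rw [Finset.prod_eq_zero (Finset.mem_univ i) (by rw [hx0 i hi, zero_pow hi']), mul_zero]
    · push Not at h
      exfalso
      have hdeg : ∑ i, m i = d := by
        have := hFhom (mem_support_iff.mp hm)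
        rw [← this, Finsupp.weight_apply, Finsupp.sum_fintype] <;> simp
      obtain ⟨k, -, hk⟩ := Finset.exists_ne_zero_of_sum_ne_zero (s := Finset.univ) (f := m) (by omega)
      have hk' : u.rev ≤ k := by
        by_contra h'
        exact hk (h k (not_le.mp h'))
      obtain ⟨i, hi, hi'⟩ := hmon m hm k (hu.trans hk') hk
      have := h i hi
      simp [this] at hi'
  · intro k
    by_cases hk : k < u
    · exact hxs _ (by simp only [s, Finset.coe_union, Finset.coe_image]; exact Or.inr ⟨k, by simpa using hk, rfl⟩)
    · have hk := not_lt.mp hk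
      conv_lhs => rw [F.as_sum, map_sum, map_sum]
      apply Finset.sum_eq_zero
      intro m hm
      rw [pderiv_monomial, eval_monomial]
      by_cases h : m k = 0
      · simp [h]
      · rw [Finsupp.prod_fintype _ _ (by simp), hmz m hm k hk h, mul_zero]

theorem stmt14 (K : Type*) [Field K] [IsAlgClosed K] (N d : ℕ)
    (hN : 2 ≤ N) (hd : 2 ≤ d)
    (F : MvPolynomial (Fin (N + 1)) K) (hF0 : F ≠ 0)
    (hFhom : F.IsHomogeneous d)
    (hsmooth : ∀ x : Fin (N + 1) → K, x ≠ 0 →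
      ¬ (eval x F = 0 ∧ ∀ i : Fin (N + 1), eval x (pderiv i F) = 0))
    (α : Fin (N + 1) → ℤ) (hmono : Monotone α) (hnz : α ≠ 0)
    (hsum : ∑ i, α i = 0) :
    (∃ m ∈ F.support, 0 ≤ ∑ i, α i * (m i : ℤ)) ∧
      (3 ≤ d → ∃ m ∈ F.support, 0 < ∑ i, α i * (m i : ℤ)) := by
  have hd' : (2 : ℤ) ≤ d := by exact_mod_cast hd
  have key : ∀ u : Fin (N + 1),
      ∃ m ∈ F.support, α u + (d - 1) * α u.rev ≤ ∑ i, α i * (m i : ℤ) := by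
    intro u
    rcases le_total u u.rev with hu | hu
    · exact key_bound K N d hd F hFhom hsmooth α hmono u hu
    · obtain ⟨m, hm, h⟩ := key_bound K N d hd F hFhom hsmooth α hmono u.rev (by simpa using hu)
      refine ⟨m, hm, le_trans ?_ h⟩
      rw [Fin.rev_rev]
      have := hmono hu
      nlinarith
  have hrev : ∑ u : Fin (N + 1), α u.rev = 0 := by
    rw [← hsum]
    exact Equiv.sum_comp Fin.revPerm α
  have hs0 : ∑ u : Fin (N + 1), (α u + (d - 1) * α u.rev) = 0 := by
    rw [Finset.sum_add_distrib, ← Finset.mul_sum, hrev, hsum]; simp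
  constructor
  · by_contra! h
    have : ∑ u : Fin (N + 1), (α u + (d - 1) * α u.rev) < 0 := by
      apply Finset.sum_neg
      · intro u _
        obtain ⟨m, hm, h'⟩ := key u
        exact h'.trans_lt (h m hm)
      · exact Finset.univ_nonempty
    omega
  · intro h3
    have h3' : (3 : ℤ) ≤ d := by exact_mod_cast h3
    by_contra! h
    have hle : ∀ u ∈ Finset.univ, α u + (d - 1) * α u.rev ≤ 0 := by
      intro u _
      obtain ⟨m, hm, h'⟩ := key u
      exact h'.trans (h m hm)
    have hz := (Finset.sum_eq_zero_iff_of_nonpos hle).mp hs0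
    apply hnz
    ext u
    have a := hz u (Finset.mem_univ _)
    have b := hz u.rev (Finset.mem_univ _)
    rw [Fin.rev_rev] at b
    have : (d : ℤ) * (d - 2) * α u = 0 := by linear_combination (d - 1) * b - a
    rcases mul_eq_zero.mp this with h | h
    · rcases mul_eq_zero.mp h with h | h <;> omega
    · simpa using h
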